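/- arXiv:0811.2475 — 3 statements merged into one kernel-verified Lean document; each statement's English description precedes it below -/
import Mathlib

section
/- Let (X, R) be a symmetric association scheme with n classes that is cometric with respect to the ordering E_0, …, E_n, and let Y ⊆ X with 1 < |Y| < |X|, with dual width w* and degree s. Then w* ≥ n − s, and if w* = n − s then (Y, R^Y) is a cometric subscheme with s classes. -/
open Matrix BigOperators
open scoped ComplexOrder

namespace AssocScheme

variable (X : Type*) [Fintype X] [DecidableEq X]

/-- A commutative association scheme with `n` classes on a finite set `X`:
adjacency matrices `A 0, …, A n`, primitive idempotents `E 0, …, E n`,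
and intersection numbers `p`. -/
structure Scheme (n : ℕ) where
  A : Fin (n + 1) → Matrix X X ℂ
  E : Fin (n + 1) → Matrix X X ℂ
  p : Fin (n + 1) → Fin (n + 1) → Fin (n + 1) → ℂ
  A_zeroOne : ∀ i x y, A i x y = 0 ∨ A i x y = 1
  A_zero : A 0 = 1
  A_sum : ∑ i, A i = Matrix.of fun _ _ => (1 : ℂ)
  A_trans : ∀ i, ∃ i', (A i)ᵀ = A i'
  A_mul : ∀ i j, A i * A j = ∑ k, p i j k • A k
  A_comm : ∀ i j, A i * A j = A j * A i
  E_zero : E 0 = (Fintype.card X : ℂ)⁻¹ • Matrix.of fun _ _ => (1 : ℂ)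
  E_ne : ∀ i, E i ≠ 0
  E_herm : ∀ i, (E i).IsHermitian
  E_mul : ∀ i j, E i * E j = if i = j then E i else 0
  E_sum : ∑ i, E i = 1
  E_span : ∀ i, E i ∈ Submodule.span ℂ (Set.range A)

variable {X}
variable {n : ℕ}

/-- The scheme is symmetric: all adjacency matrices are symmetric. -/
def Scheme.IsSym (S : Scheme X n) : Prop := ∀ i, (S.A i)ᵀ = S.A i

/-- `P` is the first eigenmatrix. -/
def Scheme.IsP (S : Scheme X n) (P : Matrix (Fin (n + 1)) (Fin (n + 1)) ℂ) : Prop :=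
  ∀ i, S.A i = ∑ j, P j i • S.E j

/-- `Q` is the second eigenmatrix. -/
def Scheme.IsQ (S : Scheme X n) (Q : Matrix (Fin (n + 1)) (Fin (n + 1)) ℂ) : Prop :=
  ∀ i, S.E i = (Fintype.card X : ℂ)⁻¹ • ∑ j, Q j i • S.A j

/-- `q` is the family of Krein parameters of the scheme. -/
def Scheme.IsKrein (S : Scheme X n) (q : Fin (n + 1) → Fin (n + 1) → Fin (n + 1) → ℂ) : Prop :=
  ∀ i j, Matrix.hadamard (S.E i) (S.E j) = (Fintype.card X : ℂ)⁻¹ • ∑ k, q i j k • S.E k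

/-- The scheme is metric (P-polynomial) w.r.t. the given ordering of the `A i`. -/
def Scheme.Metric (S : Scheme X n) : Prop :=
  ∀ i j k : Fin (n + 1), ((i : ℕ) + (j : ℕ) < (k : ℕ) → S.p i j k = 0) ∧
    ((k : ℕ) = (i : ℕ) + (j : ℕ) → S.p i j k ≠ 0)

/-- The scheme is cometric (Q-polynomial) w.r.t. the given ordering of the `E i`,
with Krein parameters `q`. -/
def Scheme.Cometric (S : Scheme X n) (q : Fin (n + 1) → Fin (n + 1) → Fin (n + 1) → ℂ) : Prop :=
  S.IsKrein q ∧ ∀ i j k : Fin (n + 1), ((i : ℕ) + (j : ℕ) < (k : ℕ) → q i j k = 0) ∧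
    ((k : ℕ) = (i : ℕ) + (j : ℕ) → q i j k ≠ 0)

/-- The scheme is imprimitive: some nontrivial relation is disconnected. -/
def Scheme.Imprimitive (S : Scheme X n) : Prop :=
  ∃ i : Fin (n + 1), i ≠ 0 ∧ ¬ ∀ x y : X, Relation.EqvGen (fun a b => S.A i a b = 1) x y

/-- The inner distribution of a subset `Y`. -/
noncomputable def innerDist (S : Scheme X n) (Y : Finset X) : Fin (n + 1) → ℂ :=
  fun i => (Y.card : ℂ)⁻¹ * ∑ x ∈ Y, ∑ y ∈ Y, S.A i x y

/-- The MacWilliams transform `aQ` of a vector `a`. -/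
noncomputable def macT (Q : Matrix (Fin (n + 1)) (Fin (n + 1)) ℂ) (a : Fin (n + 1) → ℂ) : Fin (n + 1) → ℂ :=
  fun i => ∑ j, a j * Q j i

/-- Entry `B_{x,i}` of the outer distribution of `Y`. -/
noncomputable def outerB (S : Scheme X n) (Y : Finset X) (x : X) (i : Fin (n + 1)) : ℂ :=
  ∑ y ∈ Y, S.A i x y

open scoped Fin.NatCast in
/-- `Y` is completely regular: row `x` of the outer distribution depends only on
`min{j : B_{x,j} ≠ 0}`. -/
def CompletelyRegular (S : Scheme X n) (Y : Finset X) : Prop :=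
  ∀ x x' : X,
    sInf {j : ℕ | outerB S Y x (j : Fin (n + 1)) ≠ 0} =
      sInf {j : ℕ | outerB S Y x' (j : Fin (n + 1)) ≠ 0} →
    ∀ i, outerB S Y x i = outerB S Y x' i

/-- `Y` is regular: `(A_i χ)_x = a_i` for all `x ∈ Y`. -/
def Regular (S : Scheme X n) (Y : Finset X) : Prop :=
  ∀ x ∈ Y, ∀ i, outerB S Y x i = innerDist S Y i

/-- The restriction of the scheme to `Y` (on the `s+1` relations meeting `Y`)
is a symmetric association scheme with `s` classes which is cometric with respect
to some ordering of its primitive idempotents. -/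
def CometricSubscheme (S : Scheme X n) (Y : Finset X) (s : ℕ) : Prop :=
  ∃ f : Fin (s + 1) → Fin (n + 1), Function.Injective f ∧
    (∀ j, f j = 0 ∨ innerDist S Y (f j) ≠ 0) ∧
    (∀ i : Fin (n + 1), (i = 0 ∨ innerDist S Y i ≠ 0) → ∃ j, f j = i) ∧
    ∃ (S' : Scheme {x // x ∈ Y} s) (q' : Fin (s + 1) → Fin (s + 1) → Fin (s + 1) → ℂ),
      (∀ j (y y' : {x // x ∈ Y}), S'.A j y y' = S.A (f j) y.1 y'.1) ∧
      S'.IsSym ∧ S'.Cometric q'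

end AssocScheme

namespace AssocScheme
open Polynomial

/-- matrix attached to a function on relations -/
def relMat {Y : Type*} {s : ℕ} (r : Y → Y → Fin (s+1)) :
    (Fin (s+1) → ℝ) →ₗ[ℝ] Matrix Y Y ℝ where
  toFun u := Matrix.of fun x y => u (r x y)
  map_add' u v := by ext; simp
  map_smul' c u := by ext; simp

lemma relMat_apply {Y : Type*} {s : ℕ} (r : Y → Y → Fin (s+1)) (u : Fin (s+1) → ℝ) (x y : Y) :
    relMat r u x y = u (r x y) := rfl

/-- values of a polynomial at the nodes -/
def evv {s : ℕ} (θ : Fin (s+1) → ℝ) : ℝ[X] →ₗ[ℝ] (Fin (s+1) → ℝ) where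
  toFun p := fun a => p.eval (θ a)
  map_add' u v := by ext; simp
  map_smul' c u := by ext; simp

lemma evv_apply {s : ℕ} (θ : Fin (s+1) → ℝ) (p : ℝ[X]) (a) : evv θ p a = p.eval (θ a) := rfl

lemma evv_inj {s : ℕ} (θ : Fin (s+1) → ℝ) (hθ : Function.Injective θ) (p : ℝ[X])
    (hp : p.natDegree ≤ s) (h : evv θ p = 0) : p = 0 := by
  apply Polynomial.eq_zero_of_natDegree_lt_card_of_eval_eq_zero p hθ
  · intro i; exact congrFun h i
  · simpa using Nat.lt_succ_of_le hp

lemma pade {s : ℕ} (θ ζ : Fin (s+1) → ℝ) (j : ℕ) (hj : j ≤ s) :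
    ∃ f g : ℝ[X], f.natDegree ≤ j ∧ g.natDegree ≤ s - j ∧ (f ≠ 0 ∨ g ≠ 0) ∧
      ∀ a, f.eval (θ a) = g.eval (θ a) * ζ a := by
  let Φ : (degreeLT ℝ (j+1) × degreeLT ℝ (s-j+1)) →ₗ[ℝ] (Fin (s+1) → ℝ) :=
    { toFun := fun fg a => (fg.1 : ℝ[X]).eval (θ a) - (fg.2 : ℝ[X]).eval (θ a) * ζ a
      map_add' := by intro u v; ext a; simp; ring
      map_smul' := by intro c u; ext a; simp; ring }
  have : Module.Finite ℝ (degreeLT ℝ (j+1)) := Module.Finite.equiv (degreeLTEquiv ℝ (j+1)).symm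
  have : Module.Finite ℝ (degreeLT ℝ (s-j+1)) := Module.Finite.equiv (degreeLTEquiv ℝ (s-j+1)).symm
  have hk : LinearMap.ker Φ ≠ ⊥ := by
    apply LinearMap.ker_ne_bot_of_finrank_lt
    rw [Module.finrank_prod, (degreeLTEquiv ℝ (j+1)).finrank_eq, (degreeLTEquiv ℝ (s-j+1)).finrank_eq]
    simp
    omega
  obtain ⟨⟨f, g⟩, hfg, hne⟩ := Submodule.exists_mem_ne_zero_of_ne_bot hk
  refine ⟨f, g, ?_, ?_, ?_, ?_⟩
  · have := mem_degreeLT.1 f.2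
    by_cases h : (f : ℝ[X]) = 0
    · simp [h]
    · exact Nat.lt_succ_iff.1 ((natDegree_lt_iff_degree_lt h).2 this)
  · have := mem_degreeLT.1 g.2
    by_cases h : (g : ℝ[X]) = 0
    · simp [h]
    · exact Nat.lt_succ_iff.1 ((natDegree_lt_iff_degree_lt h).2 this)
  · by_contra! h
    apply hne
    ext1
    · exact Subtype.ext h.1
    · exact Subtype.ext h.2
  · intro a
    have := congrFun (LinearMap.mem_ker.1 hfg) a
    exact sub_eq_zero.1 this

section
lemma relMat_inj {Y : Type*} {s : ℕ} (r : Y → Y → Fin (s+1)) (hsurj : ∀ a, ∃ x y, r x y = a) (u : Fin (s+1) → ℝ) (h : relMat r u = 0) : u = 0 := by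
  ext a
  obtain ⟨x, y, rfl⟩ := hsurj a
  exact congrFun (congrFun h x) y

lemma relMat_sq {Y : Type*} {s : ℕ} [Fintype Y] (r : Y → Y → Fin (s+1)) (hrs : ∀ x y, r x y = r y x) (hsurj : ∀ a, ∃ x y, r x y = a) (u : Fin (s+1) → ℝ) (h : relMat r u * relMat r u = 0) : u = 0 := by
  apply relMat_inj r hsurj
  apply Matrix.conjTranspose_mul_self_eq_zero.1
  convert h using 2
  ext x y
  simp [relMat_apply, hrs x y]

lemma zeta_ne {Y : Type*} {s : ℕ} [Fintype Y] [Nonempty Y] (r : Y → Y → Fin (s+1)) (hr0 : ∀ x y, r x y = 0 ↔ x = y) (θ ζ : Fin (s+1) → ℝ) (hθ : Function.Injective θ) (hζ : ζ 0 ≠ 0) 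
    (K : ∀ p g : ℝ[X], p.natDegree + g.natDegree < s → ∀ x z,
      ∑ y, p.eval (θ (r x y)) * (g.eval (θ (r y z)) * ζ (r y z)) = 0) (k : Fin (s+1)) : ζ k ≠ 0 := by
  intro hk
  have hk0 : k ≠ 0 := by rintro rfl; exact hζ hk
  obtain ⟨x⟩ := ‹Nonempty Y›
  let g : ℝ[X] := ∏ i ∈ (Finset.univ.erase k).erase 0, (X - C (θ i))
  have hdeg : g.natDegree < s := by
    simp only [g]
    rw [natDegree_prod_of_monic _ _ (fun i _ => monic_X_sub_C _)]
    simp [Finset.card_erase_of_mem, hk0.symm]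
    have := k.2
    have : (k:ℕ) ≠ 0 := fun h => hk0 (Fin.ext h)
    omega
  have h := K 1 g (by simpa using hdeg) x x
  rw [Finset.sum_eq_single x] at h
  · have h0 := (hr0 x x).2 rfl
    rw [h0] at h
    simp [hζ] at h
    simp only [g, eval_prod, Finset.prod_eq_zero_iff] at h
    obtain ⟨a, ha, h⟩ := h
    simp at h ha
    exact ha.1 (hθ (sub_eq_zero.1 h)).symm
  · intro b _ hb
    by_cases h1 : r b x = k
    · simp [h1, hk]
    · have : g.eval (θ (r b x)) = 0 := by
        simp only [g, eval_prod]
        apply Finset.prod_eq_zero (i := r b x)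
        · simp [h1, hr0, hb]
        · simp
      simp [this]
  · simp

lemma exists_idem {Y : Type*} {s : ℕ} [Fintype Y] [DecidableEq Y] [Nonempty Y] (r : Y → Y → Fin (s+1)) (hr0 : ∀ x y, r x y = 0 ↔ x = y) (hrs : ∀ x y, r x y = r y x) (hsurj : ∀ a, ∃ x y, r x y = a) (θ ζ : Fin (s+1) → ℝ) (hθ : Function.Injective θ) (hζ : ζ 0 ≠ 0) 
    (K : ∀ p g : ℝ[X], p.natDegree + g.natDegree < s → ∀ x z,
      ∑ y, p.eval (θ (r x y)) * (g.eval (θ (r y z)) * ζ (r y z)) = 0) : ∃ h : Fin (s+1) → ℝ[X], (∀ j, (h j).natDegree = j) ∧ (∀ j, h j ≠ 0) ∧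
    (∀ i j, relMat r (evv θ (h i)) * relMat r (evv θ (h j)) =
      if i = j then relMat r (evv θ (h i)) else 0) ∧
    (∑ j, evv θ (h j) = Pi.single 0 1) := by
  have hz := zeta_ne r hr0 θ ζ hθ hζ K
  have := fun j : Fin (s+1) => pade θ ζ j (Nat.lt_succ_iff.1 j.2)
  choose f g hf hg hfg hfgz using this
  have hf0 : ∀ j, f j ≠ 0 := by
    intro j hj
    rcases hfg j with h | h
    · exact h hj
    · apply h
      apply evv_inj θ hθ _ ((hg j).trans (Nat.sub_le _ _))
      ext a
      have := hfgz j a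
      rw [hj] at this
      simpa [hz, evv_apply] using this
  have hs : ∀ j, evv θ (f j) ≠ 0 := fun j h =>
    hf0 j (evv_inj θ hθ _ ((hf j).trans (Nat.lt_succ_iff.1 j.2)) h)
  have KM : ∀ (p : ℝ[X]) (j), p.natDegree < j.val →
      relMat r (evv θ p) * relMat r (evv θ (f j)) = 0 := by
    intro p j hp
    ext x z
    have h1 := K p (g j) (by have := hg j; have := j.2; omega) x z
    simpa [Matrix.mul_apply, relMat_apply, evv_apply, hfgz] using h1
  have hdeg : ∀ j, (f j).natDegree = j := by
    intro j
    apply le_antisymm (hf j)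
    by_contra! h
    exact hs j (relMat_sq r hrs hsurj _ (KM _ j h))
  have htr : ∀ u, (relMat r u)ᵀ = relMat r u := by
    intro u; ext x y; simp [relMat_apply, hrs x y]
  have horth : ∀ i j, i ≠ j → relMat r (evv θ (f i)) * relMat r (evv θ (f j)) = 0 := by
    intro i j hij
    rcases lt_or_gt_of_ne hij with h | h
    · exact KM _ _ (by rw [hdeg]; exact h)
    · have := KM (f j) i (by rw [hdeg]; exact h)
      have := congrArg Matrix.transpose this
      rwa [Matrix.transpose_mul, htr, htr, Matrix.transpose_zero] at this
  have hli : LinearIndependent ℝ (fun j => evv θ (f j)) := by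
    rw [Fintype.linearIndependent_iff]
    intro c hc j
    have h1 := congrArg (fun u => relMat r u * relMat r (evv θ (f j))) hc
    simp only [map_sum, map_smul, Finset.sum_mul, map_zero, zero_mul] at h1
    rw [Finset.sum_eq_single j] at h1
    · rw [Matrix.smul_mul, smul_eq_zero] at h1
      exact h1.resolve_right fun h => hs j (relMat_sq r hrs hsurj _ h)
    · intro b _ hb; rw [Matrix.smul_mul, horth b j hb, smul_zero]
    · simp
  have hspan := hli.span_eq_top_of_card_eq_finrank (by simp)
  have hone : (Pi.single 0 1 : Fin (s+1) → ℝ) ∈ Submodule.span ℝ (Set.range fun j => evv θ (f j)) := by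
    rw [hspan]; trivial
  obtain ⟨c, hc⟩ := (Submodule.mem_span_range_iff_exists_fun ℝ).1 hone
  have hI : relMat r (Pi.single 0 1 : Fin (s+1) → ℝ) = 1 := by
    ext x y
    simp [relMat_apply, Pi.single_apply, hr0, Matrix.one_apply]
  have hsq : ∀ j, c j • (relMat r (evv θ (f j)) * relMat r (evv θ (f j))) = relMat r (evv θ (f j)) := by
    intro j
    have h1 := congrArg (fun u => relMat r u * relMat r (evv θ (f j))) hc
    simp only [map_sum, map_smul, Finset.sum_mul, hI, one_mul] at h1
    rw [Finset.sum_eq_single j] at h1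
    · rwa [Matrix.smul_mul] at h1
    · intro b _ hb; rw [Matrix.smul_mul, horth b j hb, smul_zero]
    · simp
  have hc0 : ∀ j, c j ≠ 0 := by
    intro j h
    have := hsq j
    rw [h, zero_smul] at this
    exact hs j (relMat_inj r hsurj _ this.symm)
  refine ⟨fun j => c j • f j, ?_, ?_, ?_, ?_⟩
  · intro j; rw [natDegree_smul _ (hc0 j), hdeg]
  · intro j; exact smul_ne_zero (hc0 j) (hf0 j)
  · intro i j
    split_ifs with h
    · subst h
      simp only [map_smul]
      rw [Matrix.smul_mul, Matrix.mul_smul, hsq]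
    · simp only [map_smul]
      rw [Matrix.smul_mul, Matrix.mul_smul, horth i j h]; simp
  · simp only [map_smul]; exact hc

lemma real_main {Y : Type*} {s : ℕ} [Fintype Y] [DecidableEq Y] [Nonempty Y] (r : Y → Y → Fin (s+1)) (hr0 : ∀ x y, r x y = 0 ↔ x = y) (hrs : ∀ x y, r x y = r y x) (hsurj : ∀ a, ∃ x y, r x y = a) (θ ζ : Fin (s+1) → ℝ) (hθ : Function.Injective θ) (hζ : ζ 0 ≠ 0) 
    (K : ∀ p g : ℝ[X], p.natDegree + g.natDegree < s → ∀ x z,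
      ∑ y, p.eval (θ (r x y)) * (g.eval (θ (r y z)) * ζ (r y z)) = 0) : ∃ (h : Fin (s+1) → Fin (s+1) → ℝ)
    (p q : Fin (s+1) → Fin (s+1) → Fin (s+1) → ℝ),
    (∀ i j, relMat r (h i) * relMat r (h j) = if i = j then relMat r (h i) else 0) ∧
    (∑ j, relMat r (h j) = 1) ∧
    (∀ a, h 0 a = (Fintype.card Y : ℝ)⁻¹) ∧
    (∀ j, relMat r (h j) ≠ 0) ∧
    (∀ i j, relMat r (Pi.single i 1) * relMat r (Pi.single j 1) = relMat r (p i j)) ∧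
    (∀ i j a, h i a * h j a = (Fintype.card Y : ℝ)⁻¹ * ∑ k, q i j k * h k a) ∧
    (∀ i j k : Fin (s+1), ((i : ℕ) + (j : ℕ) < (k : ℕ) → q i j k = 0) ∧
    ((k : ℕ) = (i : ℕ) + (j : ℕ) → q i j k ≠ 0)) := by
  obtain ⟨h, hdeg, hne, hmul, hsum⟩ := exists_idem r hr0 hrs hsurj θ ζ hθ hζ K
  have hle : ∀ j, (h j).natDegree ≤ s := fun j => by rw [hdeg]; exact Nat.lt_succ_iff.1 j.2
  have hev0 : ∀ j, evv θ (h j) ≠ 0 := fun j hj => hne j (evv_inj θ hθ _ (hle j) hj)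
  have hM0 : ∀ j, relMat r (evv θ (h j)) ≠ 0 := fun j hj => hev0 j (relMat_inj r hsurj _ hj)
  have hI : relMat r (Pi.single 0 1 : Fin (s+1) → ℝ) = 1 := by
    ext x y
    simp [relMat_apply, Pi.single_apply, hr0, Matrix.one_apply]
  have hli : LinearIndependent ℝ (fun j => evv θ (h j)) := by
    rw [Fintype.linearIndependent_iff]
    intro c hc j
    have h1 := congrArg (fun u => relMat r u * relMat r (evv θ (h j))) hc
    simp only [map_sum, map_smul, Finset.sum_mul, map_zero, zero_mul] at h1
    simp only [Matrix.smul_mul, hmul, smul_ite, smul_zero, Finset.sum_ite_eq', Finset.mem_univ,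
      if_true] at h1
    exact (smul_eq_zero.1 h1).resolve_right (hM0 j)
  have hspan := hli.span_eq_top_of_card_eq_finrank (by simp)
  have hex : ∀ u : Fin (s+1) → ℝ, ∃ c : Fin (s+1) → ℝ, ∑ k, c k • evv θ (h k) = u := by
    intro u
    apply (Submodule.mem_span_range_iff_exists_fun ℝ).1
    rw [hspan]; trivial
  have hY : (Fintype.card Y : ℝ) ≠ 0 := by simp
  choose co hco using hex
  have hprod : ∀ u v, relMat r u * relMat r v = relMat r (∑ k, (co u k * co v k) • evv θ (h k)) := by
    intro u v
    conv_lhs => rw [← hco u, ← hco v]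
    simp only [map_sum, map_smul, Finset.sum_mul, Finset.mul_sum, Matrix.smul_mul, Matrix.mul_smul,
      hmul, smul_ite, smul_zero, Finset.sum_ite_eq', Finset.mem_univ, if_true,
      smul_smul]
    exact Finset.sum_congr rfl fun x _ => by rw [mul_comm]
  refine ⟨fun j => evv θ (h j), fun i j => ∑ k, (co (Pi.single i 1) k * co (Pi.single j 1) k) • evv θ (h k),
    fun i j k => Fintype.card Y * co (evv θ (h i * h j)) k, hmul, ?_, ?_, hM0, fun i j => hprod _ _, ?_, ?_⟩
  · rw [← map_sum, hsum, hI]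
  · have h0 := eq_C_of_natDegree_eq_zero (hdeg 0)
    set c := (h 0).coeff 0 with hc
    have hc0 : c ≠ 0 := by
      intro hc0
      apply hne 0; rw [h0, hc0]; simp
    intro a
    obtain ⟨x⟩ := ‹Nonempty Y›
    have := congrFun (congrFun (hmul 0 0) x) x
    rw [h0] at this
    simp [Matrix.mul_apply, relMat_apply, evv_apply] at this
    change eval (θ a) (h 0) = _
    rw [h0, eval_C]
    field_simp
    have h2 : c * (c * Fintype.card Y) = c * 1 := by linarith
    exact mul_left_cancel₀ hc0 h2
  · intro i j a
    have := congrFun (hco (evv θ (h i * h j))) a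
    simp [evv_apply] at this
    simp only [evv_apply, ← this, mul_assoc, ← Finset.mul_sum]
    field_simp
  · intro i j k
    by_cases hij : (i : ℕ) + j ≤ s
    · set c := co (evv θ (h i * h j)) with hc
      have hd : (h i * h j).degree = ((i + j : ℕ) : WithBot ℕ) := by
        rw [degree_mul, degree_eq_natDegree (hne i), degree_eq_natDegree (hne j), hdeg, hdeg]; rfl
      have hpoly : ∑ k, c k • h k = h i * h j := by
        rw [← sub_eq_zero]
        apply evv_inj θ hθ
        · apply (natDegree_sub_le _ _).trans
          apply max_le
          · apply natDegree_sum_le_of_forall_le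
            intro i _
            exact (natDegree_smul_le _ _).trans (hle i)
          · rw [natDegree_eq_of_degree_eq_some hd]; exact hij
        · rw [map_sub, map_sum]
          simp only [map_smul]
          rw [hco]; simp
      have hdk : ∀ k, c k ≠ 0 → (c k • h k).degree = ((k : ℕ) : WithBot ℕ) := by
        intro k hk
        rw [degree_eq_natDegree (smul_ne_zero hk (hne k)), natDegree_smul _ hk, hdeg]
      have hsup := degree_sum_eq_of_disjoint (fun k => c k • h k) Finset.univ (by
        intro a ha b hb hab
        simp at ha hb
        simp only [Function.onFun, Function.comp]
        rw [hdk a ha.1, hdk b hb.1]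
        intro h; apply hab; exact Fin.ext (by exact_mod_cast h))
      rw [hpoly, hd] at hsup
      constructor
      · intro hk
        by_contra hck
        have hck : c k ≠ 0 := fun h => hck (by simp [← hc, h])
        have := Finset.le_sup (f := fun k => (c k • h k).degree) (Finset.mem_univ k)
        rw [hdk k hck] at this
        have h3 := hsup ▸ this
        have : (k:ℕ) ≤ i + j := by exact_mod_cast h3
        omega
      · intro hk
        apply mul_ne_zero hY
        intro hck
        obtain ⟨b, _, hb⟩ := Finset.exists_mem_eq_sup Finset.univ ⟨k, Finset.mem_univ _⟩ (fun k => (c k • h k).degree)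
        have hb' := hsup.trans hb
        by_cases hcb : c b = 0
        · simp only [hcb, zero_smul, degree_zero] at hb'
          exact absurd hb' (by simp)
        · have hb'' := hb'.trans (hdk b hcb)
          have : (i + j : ℕ) = (b:ℕ) := by exact_mod_cast hb''
          have : b = k := Fin.ext (by omega)
          exact hcb (this ▸ hck)
    · have := k.2
      constructor <;> intro <;> omega

lemma build {Y : Type*} {s : ℕ} [Fintype Y] [DecidableEq Y] [Nonempty Y] (r : Y → Y → Fin (s+1)) (hr0 : ∀ x y, r x y = 0 ↔ x = y) (hrs : ∀ x y, r x y = r y x) (hsurj : ∀ a, ∃ x y, r x y = a) (θ ζ : Fin (s+1) → ℝ) (hθ : Function.Injective θ) (hζ : ζ 0 ≠ 0) 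
    (K : ∀ p g : ℝ[X], p.natDegree + g.natDegree < s → ∀ x z,
      ∑ y, p.eval (θ (r x y)) * (g.eval (θ (r y z)) * ζ (r y z)) = 0) : ∃ (S' : Scheme Y s) (q' : Fin (s + 1) → Fin (s + 1) → Fin (s + 1) → ℂ),
    (∀ j x y, S'.A j x y = if r x y = j then 1 else 0) ∧ S'.IsSym ∧ S'.Cometric q' := by
  obtain ⟨h, p, q, hmul, hsum, h0, hne, hp, hq, hcom⟩ := real_main r hr0 hrs hsurj θ ζ hθ hζ K
  let φ : Matrix Y Y ℝ →+* Matrix Y Y ℂ := Complex.ofRealHom.mapMatrix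
  have hφ : ∀ M x y, φ M x y = ((M x y : ℝ) : ℂ) := fun M x y => rfl
  let A : Fin (s+1) → Matrix Y Y ℂ := fun j => φ (relMat r (Pi.single j 1))
  have hA : ∀ j x y, A j x y = if r x y = j then 1 else 0 := by
    intro j x y
    simp only [A, hφ, relMat_apply, Pi.single_apply]
    split_ifs <;> simp
  have hAT : ∀ j, (A j)ᵀ = A j := by
    intro j; ext x y; rw [Matrix.transpose_apply, hA, hA, hrs]
  have hexp : ∀ u : Fin (s+1) → ℝ, φ (relMat r u) = ∑ k, (u k : ℂ) • A k := by
    intro u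
    ext x y
    rw [Matrix.sum_apply]
    simp [hφ, relMat_apply, hA]
  have hAmul : ∀ i j, A i * A j = ∑ k, (p i j k : ℂ) • A k := by
    intro i j
    rw [← hexp, ← hp, map_mul]
  have hEH : ∀ i, (φ (relMat r (h i))).IsHermitian := by
    intro i
    ext x y
    rw [Matrix.conjTranspose_apply, hφ, hφ, relMat_apply, relMat_apply, hrs y x]
    simp
  let S' : Scheme Y s :=
    { A := A
      E := fun j => φ (relMat r (h j))
      p := fun i j k => (p i j k : ℂ)
      A_zeroOne := by
        intro i x y
        rw [hA]; split_ifs <;> simp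
      A_zero := by
        ext x y
        rw [hA, Matrix.one_apply]
        simp [hr0]
      A_sum := by
        ext x y
        rw [Matrix.sum_apply]
        simp [hA]
      A_trans := fun i => ⟨i, hAT i⟩
      A_mul := hAmul
      A_comm := by
        intro i j
        have : (A i * A j)ᵀ = A i * A j := by
          rw [hAmul, Matrix.transpose_sum]
          simp only [Matrix.transpose_smul, hAT]
        rw [← this, Matrix.transpose_mul, hAT, hAT]
      E_zero := by
        ext x y
        simp [hφ, relMat_apply, h0]
      E_ne := by
        intro i hi
        apply hne i
        ext x y
        have := congrFun (congrFun hi x) y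
        rw [hφ] at this
        exact Complex.ofReal_eq_zero.1 this
      E_herm := hEH
      E_mul := by
        intro i j
        rw [← map_mul, hmul]
        split_ifs <;> simp
      E_sum := by rw [← map_sum, hsum, map_one]
      E_span := by
        intro i
        rw [hexp]
        exact Submodule.sum_mem _ fun k _ =>
          Submodule.smul_mem _ _ (Submodule.subset_span ⟨k, rfl⟩) }
  refine ⟨S', fun i j k => (q i j k : ℂ), hA, hAT, ?_, ?_⟩
  · intro i j
    ext x y
    have := hq i j (r x y)
    have h2 : ((h i (r x y) * h j (r x y) : ℝ) : ℂ) = _ := congrArg Complex.ofReal this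
    simp only [Matrix.hadamard_apply, Matrix.smul_apply, Matrix.sum_apply, S', hφ, relMat_apply,
      smul_eq_mul]
    push_cast at h2
    exact h2
  · intro i j k
    refine ⟨fun hk => ?_, fun hk => ?_⟩
    · simp [(hcom i j k).1 hk]
    · simpa using (hcom i j k).2 hk
end
end AssocScheme

namespace AssocScheme
open Polynomial

lemma exists_rel {X : Type*} [Fintype X] [DecidableEq X] {n : ℕ} (S : Scheme X n) :
    ∃ r : X → X → Fin (n+1), ∀ i x y, S.A i x y = if r x y = i then 1 else 0 := by
  have : ∀ x y, ∃ k, ∀ i, S.A i x y = if k = i then 1 else 0 := by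
    intro x y
    have hs := congrFun (congrFun S.A_sum x) y
    rw [Matrix.sum_apply] at hs
    have h1 : ∀ i, S.A i x y = if S.A i x y = 1 then 1 else 0 := by
      intro i
      rcases S.A_zeroOne i x y with h | h <;> simp [h]
    have h2 : ∑ i, S.A i x y = ∑ i, if S.A i x y = 1 then (1:ℂ) else 0 :=
      Finset.sum_congr rfl fun i _ => h1 i
    rw [h2, Finset.sum_boole] at hs
    have hs : (Finset.univ.filter fun i => S.A i x y = 1).card = 1 := by
      simp only [Matrix.of_apply] at hs
      exact_mod_cast hs
    obtain ⟨k, hk⟩ := Finset.card_eq_one.1 hs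
    refine ⟨k, fun i => ?_⟩
    have hi : S.A i x y = 1 ↔ i = k := by
      have := Finset.ext_iff.1 hk i
      simpa using this
    rw [h1 i]
    by_cases h : i = k
    · rw [if_pos (hi.2 h), if_pos h.symm]
    · rw [if_neg (fun h' => h (hi.1 h')), if_neg (fun h' => h h'.symm)]
  choose r hr using this
  exact ⟨r, fun i x y => hr x y i⟩

section
variable {X : Type*} [Fintype X] [DecidableEq X] {n : ℕ} (S : Scheme X n)

lemma E_linInd : LinearIndependent ℂ S.E := by
  rw [Fintype.linearIndependent_iff]
  intro c hc j
  have h1 := congrArg (fun u => u * S.E j) hc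
  simp only [Finset.sum_mul, zero_mul, Matrix.smul_mul, S.E_mul, smul_ite, smul_zero,
    Finset.sum_ite_eq', Finset.mem_univ, if_true] at h1
  exact (smul_eq_zero.1 h1).resolve_right (S.E_ne j)

lemma span_eq : Submodule.span ℂ (Set.range S.E) = Submodule.span ℂ (Set.range S.A) := by
  apply Submodule.eq_of_le_of_finrank_le
  · rw [Submodule.span_le]
    rintro _ ⟨i, rfl⟩
    exact S.E_span i
  · rw [finrank_span_eq_card (E_linInd S)]
    exact finrank_range_le_card S.A

lemma E_symm (hsym : S.IsSym) (i) : (S.E i)ᵀ = S.E i := by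
  have h := S.E_span i
  generalize S.E i = M at h ⊢
  induction h using Submodule.span_induction with
  | mem x hx => obtain ⟨i, rfl⟩ := hx; exact hsym i
  | zero => simp
  | add x y _ _ hx hy => rw [Matrix.transpose_add, hx, hy]
  | smul c x _ hx => rw [Matrix.transpose_smul, hx]

lemma E_conj (hsym : S.IsSym) (i x y) : star (S.E i x y) = S.E i x y := by
  rw [← Matrix.conjTranspose_apply, S.E_herm i, ← Matrix.transpose_apply (S.E i), E_symm S hsym]

lemma E_real (hsym : S.IsSym) (i x y) : (((S.E i x y).re : ℝ) : ℂ) = S.E i x y :=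
  Complex.conj_eq_iff_re.1 (E_conj S hsym i x y)

lemma tr_ne (k) : (S.E k).trace ≠ 0 := by
  intro h
  have h2 : (S.E k)ᴴ * S.E k = S.E k := by
    rw [S.E_herm k, S.E_mul, if_pos rfl]
  rw [← h2, Matrix.trace_conjTranspose_mul_self_eq_zero_iff] at h
  exact S.E_ne k h

variable {q : Fin (n + 1) → Fin (n + 1) → Fin (n + 1) → ℂ}

lemma triple (hsym : S.IsSym) (hK : S.IsKrein q) (i j k) :
    ∑ x, ∑ y, S.E i x y * S.E j x y * S.E k x y =
      (Fintype.card X : ℂ)⁻¹ * q i j k * (S.E k).trace := by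
  have h := congrArg (fun M => (M * S.E k).trace) (hK i j)
  simp only [Matrix.smul_mul, Finset.sum_mul, S.E_mul, smul_ite, smul_zero,
    Finset.sum_ite_eq', Finset.mem_univ, if_true, Matrix.trace_smul] at h
  rw [smul_eq_mul, smul_eq_mul, ← mul_assoc] at h
  rw [← h]
  simp only [Matrix.trace, Matrix.diag, Matrix.mul_apply, Matrix.hadamard_apply]
  refine Finset.sum_congr rfl fun x _ => Finset.sum_congr rfl fun y _ => ?_
  congr 1
  rw [← Matrix.transpose_apply (S.E k), E_symm S hsym]

variable [Nonempty X]

lemma krein_zero (hsym : S.IsSym) (hcom : S.Cometric q) (i j k : Fin (n+1))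
    (h : (i:ℕ) + k < j) : q i j k = 0 := by
  have h1 := triple S hsym hcom.1 i j k
  have h2 := triple S hsym hcom.1 i k j
  rw [(hcom.2 i k j).1 h] at h2
  have h3 : ∑ x, ∑ y, S.E i x y * S.E j x y * S.E k x y =
      ∑ x, ∑ y, S.E i x y * S.E k x y * S.E j x y :=
    Finset.sum_congr rfl fun x _ => Finset.sum_congr rfl fun y _ => by ring
  rw [h3, h2] at h1
  simpa [tr_ne] using h1

variable (Y : Finset X)

/-- diagonal projection onto Y -/
def dia (Y : Finset X) : Matrix X X ℂ := Matrix.diagonal fun x => if x ∈ Y then 1 else 0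

lemma mul_dia_mul (M N : Matrix X X ℂ) (x z : X) :
    (M * dia Y * N) x z = ∑ y ∈ Y, M x y * N y z := by
  rw [Matrix.mul_apply]
  simp only [dia, Matrix.mul_diagonal, mul_ite, mul_one, mul_zero, ite_mul, zero_mul]
  rw [Finset.sum_ite_mem, Finset.univ_inter]

/-- if the quadratic forms of Y vanish above w, E_a D E_b = 0 -/
lemma E_dia_E (hsym : S.IsSym) (hcom : S.Cometric q) (w : ℕ)
    (hw : ∀ k : Fin (n+1), w < k → ∑ x ∈ Y, ∑ y ∈ Y, S.E k x y = 0)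
    (a b : Fin (n+1)) (hab : (a:ℕ) + w < b) : S.E a * dia Y * S.E b = 0 := by
  rw [← Matrix.trace_mul_conjTranspose_self_eq_zero_iff]
  have hd : (dia Y)ᴴ = dia Y := by
    rw [dia, Matrix.diagonal_conjTranspose]
    congr 1; ext x; simp only [Pi.star_apply]; split_ifs <;> simp
  rw [Matrix.conjTranspose_mul, Matrix.conjTranspose_mul, S.E_herm, S.E_herm, hd]
  have h1 : S.E a * dia Y * S.E b * (S.E b * (dia Y * S.E a)) =
      S.E a * (dia Y * S.E b * dia Y * S.E a) := by
    have : S.E b * S.E b = S.E b := by rw [S.E_mul, if_pos rfl]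
    calc _ = S.E a * dia Y * (S.E b * S.E b) * dia Y * S.E a := by simp only [Matrix.mul_assoc]
      _ = _ := by rw [this]; simp only [Matrix.mul_assoc]
  have h2 : S.E a * S.E a = S.E a := by rw [S.E_mul, if_pos rfl]
  rw [h1, Matrix.trace_mul_comm, Matrix.mul_assoc, h2]
  have h3 : (dia Y * S.E b * dia Y * S.E a).trace = ∑ x ∈ Y, ∑ y ∈ Y, (S.E a ⊙ S.E b) x y := by
    simp only [Matrix.trace, Matrix.diag, mul_dia_mul]
    rw [← Finset.sum_subset (Finset.subset_univ Y)]
    · refine Finset.sum_congr rfl fun x hx => Finset.sum_congr rfl fun y _ => ?_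
      rw [dia, Matrix.diagonal_mul, if_pos hx, one_mul, Matrix.hadamard_apply, mul_comm]
      congr 1
      rw [← Matrix.transpose_apply (S.E a), E_symm S hsym]
    · intro x _ hx
      refine Finset.sum_eq_zero fun y _ => ?_
      rw [dia, Matrix.diagonal_mul, if_neg hx]; simp
  rw [h3, hcom.1 a b]
  simp only [Matrix.smul_apply, Matrix.sum_apply, smul_eq_mul]
  have h4 : ∀ x, ∑ y ∈ Y, (Fintype.card X : ℂ)⁻¹ * ∑ k, q a b k * S.E k x y =
      ∑ k, (Fintype.card X : ℂ)⁻¹ * q a b k * ∑ y ∈ Y, S.E k x y := by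
    intro x
    simp only [Finset.mul_sum]
    rw [Finset.sum_comm]
    simp only [mul_assoc]
  simp only [h4]
  rw [Finset.sum_comm]
  refine Finset.sum_eq_zero fun k _ => ?_
  rw [← Finset.mul_sum]
  by_cases hk : w < k
  · rw [hw k hk, mul_zero]
  · rw [krein_zero S hsym hcom a b k (by omega)]; simp

lemma pow_mem (hn : 1 ≤ n) (hcom : S.Cometric q) (k : ℕ) (hk : k ≤ n) :
    (Matrix.of fun x y => S.E ⟨1, by omega⟩ x y ^ k) ∈
      Submodule.span ℂ (Set.image S.E {a | (a:ℕ) ≤ k}) := by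
  have hX : (Fintype.card X : ℂ) ≠ 0 := by simp
  induction k with
  | zero =>
    have : (Matrix.of fun x y => S.E ⟨1, by omega⟩ x y ^ 0) = (Fintype.card X : ℂ) • S.E 0 := by
      rw [S.E_zero, smul_smul, mul_inv_cancel₀ hX]
      ext; simp
    rw [this]
    exact Submodule.smul_mem _ _ (Submodule.subset_span ⟨0, by simp, rfl⟩)
  | succ k ih =>
    have h1 := ih (by omega)
    have h2 : ∀ M ∈ Submodule.span ℂ (Set.image S.E {a | (a:ℕ) ≤ k}),
        S.E ⟨1, by omega⟩ ⊙ M ∈ Submodule.span ℂ (Set.image S.E {a | (a:ℕ) ≤ k + 1}) := by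
      intro M hM
      induction hM using Submodule.span_induction with
      | mem x hx =>
        obtain ⟨a, ha, rfl⟩ := hx
        rw [hcom.1]
        refine Submodule.smul_mem _ _ (Submodule.sum_mem _ fun c _ => ?_)
        by_cases hc : (c:ℕ) ≤ k + 1
        · exact Submodule.smul_mem _ _ (Submodule.subset_span ⟨c, hc, rfl⟩)
        · rw [(hcom.2 _ a c).1 (by simp at ha ⊢; omega), zero_smul]
          exact Submodule.zero_mem _
      | zero => simp
      | add x y _ _ hx hy => rw [Matrix.hadamard_add]; exact Submodule.add_mem _ hx hy
      | smul c x _ hx => rw [Matrix.hadamard_smul]; exact Submodule.smul_mem _ _ hx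
    convert h2 _ h1 using 1
    ext x y
    simp [pow_succ, mul_comm]

lemma pow_last_mem (hn : 1 ≤ n) (hsym : S.IsSym) (hcom : S.Cometric q) (k : ℕ) (hk : k ≤ n) :
    (Matrix.of fun x y => S.E ⟨1, by omega⟩ x y ^ k * S.E (Fin.last n) x y) ∈
      Submodule.span ℂ (Set.image S.E {a | n ≤ (a:ℕ) + k}) := by
  have h2 : ∀ M ∈ Submodule.span ℂ (Set.image S.E {a | (a:ℕ) ≤ k}),
      M ⊙ S.E (Fin.last n) ∈ Submodule.span ℂ (Set.image S.E {a | n ≤ (a:ℕ) + k}) := by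
    intro M hM
    induction hM using Submodule.span_induction with
    | mem x hx =>
      obtain ⟨a, ha, rfl⟩ := hx
      rw [hcom.1]
      refine Submodule.smul_mem _ _ (Submodule.sum_mem _ fun c _ => ?_)
      by_cases hc : n ≤ (c:ℕ) + k
      · exact Submodule.smul_mem _ _ (Submodule.subset_span ⟨c, hc, rfl⟩)
      · rw [krein_zero S hsym hcom a _ c (by simp at ha ⊢; omega), zero_smul]
        exact Submodule.zero_mem _
    | zero => simp
    | add x y _ _ hx hy => rw [Matrix.add_hadamard]; exact Submodule.add_mem _ hx hy
    | smul c x _ hx => rw [Matrix.smul_hadamard]; exact Submodule.smul_mem _ _ hx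
  exact h2 _ (pow_mem S hn hcom k hk)

lemma key_pow (hn : 1 ≤ n) (hsym : S.IsSym) (hcom : S.Cometric q) (w : ℕ)
    (hw : ∀ k : Fin (n+1), w < k → ∑ x ∈ Y, ∑ y ∈ Y, S.E k x y = 0)
    (j k : ℕ) (hjk : j + k + w < n) (x z : X) :
    ∑ y ∈ Y, S.E ⟨1, by omega⟩ x y ^ j * (S.E ⟨1, by omega⟩ y z ^ k * S.E (Fin.last n) y z) = 0 := by
  have h1 := pow_mem S hn hcom j (by omega)
  have h2 := pow_last_mem S hn hsym hcom k (by omega)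
  have h3 : ∀ M ∈ Submodule.span ℂ (Set.image S.E {a | (a:ℕ) ≤ j}),
      ∀ N ∈ Submodule.span ℂ (Set.image S.E {a | n ≤ (a:ℕ) + k}), M * dia Y * N = 0 := by
    intro M hM N hN
    induction hM using Submodule.span_induction with
    | mem x hx =>
      obtain ⟨a, ha, rfl⟩ := hx
      induction hN using Submodule.span_induction with
      | mem x hx =>
        obtain ⟨b, hb, rfl⟩ := hx
        exact E_dia_E S Y hsym hcom w hw a b (by simp at ha hb; omega)
      | zero => simp
      | add x y _ _ hx hy => rw [Matrix.mul_add, hx, hy, add_zero]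
      | smul c x _ hx => rw [Matrix.mul_smul, hx, smul_zero]
    | zero => simp
    | add x y _ _ hx hy => rw [Matrix.add_mul, Matrix.add_mul, hx, hy, add_zero]
    | smul c x _ hx => rw [Matrix.smul_mul, Matrix.smul_mul, hx, smul_zero]
  have h4 := congrFun (congrFun (h3 _ h1 _ h2) x) z
  rw [mul_dia_mul] at h4
  exact h4

lemma key_real (hn : 1 ≤ n) (hsym : S.IsSym) (hcom : S.Cometric q) (w : ℕ)
    (hw : ∀ k : Fin (n+1), w < k → ∑ x ∈ Y, ∑ y ∈ Y, S.E k x y = 0)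
    (p g : ℝ[X]) (hpg : p.natDegree + g.natDegree + w < n) (x z : X) :
    ∑ y ∈ Y, p.eval (S.E ⟨1, by omega⟩ x y).re *
      (g.eval (S.E ⟨1, by omega⟩ y z).re * (S.E (Fin.last n) y z).re) = 0 := by
  have hp : ∀ j k, j + k + w < n → ∑ y ∈ Y, (S.E ⟨1, by omega⟩ x y).re ^ j *
      ((S.E ⟨1, by omega⟩ y z).re ^ k * (S.E (Fin.last n) y z).re) = 0 := by
    intro j k hjk
    have := key_pow S Y hn hsym hcom w hw j k hjk x z
    have h2 : ((∑ y ∈ Y, (S.E ⟨1, by omega⟩ x y).re ^ j *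
      ((S.E ⟨1, by omega⟩ y z).re ^ k * (S.E (Fin.last n) y z).re) : ℝ) : ℂ) = 0 := by
      push_cast
      simp only [E_real S hsym]
      exact this
    exact_mod_cast h2
  simp only [eval_eq_sum_range, Finset.sum_mul, Finset.mul_sum]
  rw [Finset.sum_comm]
  refine Finset.sum_eq_zero fun i hi => ?_
  rw [Finset.sum_comm]
  refine Finset.sum_eq_zero fun j hj => ?_
  have h1 := hp j i (by simp at hi hj; omega)
  calc _ = p.coeff j * g.coeff i * ∑ y ∈ Y, (S.E ⟨1, by omega⟩ x y).re ^ j *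
      ((S.E ⟨1, by omega⟩ y z).re ^ i * (S.E (Fin.last n) y z).re) := by
        rw [Finset.mul_sum]
        exact Finset.sum_congr rfl fun y _ => by ring
    _ = 0 := by rw [h1, mul_zero]

lemma E_one_sep (hn : 1 ≤ n) (hcom : S.Cometric q) (hX : Nonempty X) (x y x' y' : X)
    (h : S.E ⟨1, by omega⟩ x y = S.E ⟨1, by omega⟩ x' y') (i) : S.A i x y = S.A i x' y' := by
  have hE : ∀ j, ∀ hj : j < n + 1, S.E ⟨j, hj⟩ x y = S.E ⟨j, hj⟩ x' y' := by
    intro j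
    induction j using Nat.strong_induction_on with
    | _ j ih =>
      intro hj
      rcases j with _ | j
      · have : (⟨0, hj⟩ : Fin (n+1)) = 0 := rfl
        rw [this, S.E_zero]; simp
      · have hk := hcom.1 ⟨1, by omega⟩ ⟨j, by omega⟩
        have h1 := congrFun (congrFun hk x) y
        have h2 := congrFun (congrFun hk x') y'
        have hq := (hcom.2 ⟨1, by omega⟩ ⟨j, by omega⟩ ⟨j+1, hj⟩).2 (by simp; omega)
        simp only [Matrix.hadamard_apply, Matrix.smul_apply, Matrix.sum_apply, smul_eq_mul] at h1 h2
        rw [h, ih j (by omega) (by omega), h2] at h1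
        have hXc : (Fintype.card X : ℂ)⁻¹ ≠ 0 := by simp
        have h3 := mul_left_cancel₀ hXc h1
        rw [← sub_eq_zero, ← Finset.sum_sub_distrib, Finset.sum_eq_single ⟨j+1, hj⟩] at h3
        · rw [← mul_sub] at h3
          exact (sub_eq_zero.1 ((mul_eq_zero.1 h3).resolve_left hq)).symm
        · intro b _ hb
          rcases lt_or_ge (j+1) (b:ℕ) with h4 | h4
          · rw [(hcom.2 _ _ b).1 (by simp; omega)]; ring
          · have h5 : (b:ℕ) ≠ j + 1 := fun h => hb (Fin.ext h)
            have := ih b (by omega) b.2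
            simp only [Fin.eta] at this
            rw [this, sub_self]
        · simp
  have hA : S.A i ∈ Submodule.span ℂ (Set.range S.E) := by
    rw [span_eq]; exact Submodule.subset_span ⟨i, rfl⟩
  generalize S.A i = M at hA ⊢
  induction hA using Submodule.span_induction with
  | mem M hM => obtain ⟨j, rfl⟩ := hM; exact hE j j.2
  | zero => rfl
  | add M N _ _ hM hN => rw [Matrix.add_apply, Matrix.add_apply, hM, hN]
  | smul c M _ hM => rw [Matrix.smul_apply, Matrix.smul_apply, hM]

end
end AssocScheme

namespace AssocScheme
open Polynomial

/-- in a cometric scheme, the dual width satisfies `w* ≥ n − s`, and if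
`w* = n − s` then `(Y, R^Y)` is a cometric subscheme with `s` classes. -/
theorem dual_width_bound {X : Type*} [Fintype X] [DecidableEq X]
    [Nonempty X] {n : ℕ} (hn : 1 ≤ n) (S : Scheme X n) (hsym : S.IsSym)
    (q : Fin (n + 1) → Fin (n + 1) → Fin (n + 1) → ℂ) (hcom : S.Cometric q)
    (Q : Matrix (Fin (n + 1)) (Fin (n + 1)) ℂ) (hQ : S.IsQ Q)
    (Y : Finset X) (hY1 : 1 < Y.card) (hY2 : Y.card < Fintype.card X)
    (ws : Fin (n + 1))
    (hws : IsGreatest {i : Fin (n + 1) | macT Q (innerDist S Y) i ≠ 0} ws) :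
    n - Nat.card {i : Fin (n + 1) | i ≠ 0 ∧ innerDist S Y i ≠ 0} ≤ (ws : ℕ) ∧
      ((ws : ℕ) = n - Nat.card {i : Fin (n + 1) | i ≠ 0 ∧ innerDist S Y i ≠ 0} →
        CometricSubscheme S Y (Nat.card {i : Fin (n + 1) | i ≠ 0 ∧ innerDist S Y i ≠ 0})) := by
  classical
  obtain ⟨r, hr⟩ := exists_rel S
  have hYne : Y.Nonempty := Finset.card_pos.1 (by omega)
  obtain ⟨y₀, hy₀⟩ := hYne
  have hYc : (Y.card : ℂ) ≠ 0 := by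
    have : Y.card ≠ 0 := by omega
    exact_mod_cast this
  have hXc : (Fintype.card X : ℂ) ≠ 0 := by simp
  have hE : ∀ i x y, S.E i x y = (Fintype.card X : ℂ)⁻¹ * Q (r x y) i := by
    intro i x y
    have := congrFun (congrFun (hQ i) x) y
    rw [this, Matrix.smul_apply, Matrix.sum_apply]
    simp [hr]
  have hrsym : ∀ x y, r x y = r y x := by
    intro x y
    have h1 : S.A (r y x) x y = S.A (r y x) y x := by
      rw [← Matrix.transpose_apply (S.A _), hsym]
    rw [hr, hr, if_pos rfl] at h1
    by_contra h
    rw [if_neg h] at h1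
    exact zero_ne_one h1
  have hr0 : ∀ x y, r x y = 0 ↔ x = y := by
    intro x y
    have h1 := hr 0 x y
    rw [S.A_zero, Matrix.one_apply] at h1
    by_cases h : x = y
    · rw [if_pos h] at h1
      by_cases h' : r x y = 0
      · simp [h, h'] ; rw [← h]; rw [← h] at h'; exact h'
      · rw [if_neg h'] at h1; exact absurd h1 one_ne_zero
    · rw [if_neg h] at h1
      by_cases h' : r x y = 0
      · rw [if_pos h'] at h1; exact absurd h1 zero_ne_one
      · simp [h, h']
  have ha : ∀ i, innerDist S Y i ≠ 0 ↔ ∃ x ∈ Y, ∃ y ∈ Y, r x y = i := by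
    intro i
    have h1 : innerDist S Y i = (Y.card : ℂ)⁻¹ * (((Y ×ˢ Y).filter fun z => r z.1 z.2 = i).card : ℂ) := by
      rw [innerDist, ← Finset.sum_boole, Finset.sum_product]
      simp only [hr]
    rw [h1, mul_ne_zero_iff, Nat.cast_ne_zero, Finset.card_ne_zero]
    constructor
    · rintro ⟨_, ⟨z, hz⟩⟩
      simp only [Finset.mem_filter, Finset.mem_product] at hz
      exact ⟨z.1, hz.1.1, z.2, hz.1.2, hz.2⟩
    · rintro ⟨x, hx, y, hy, h⟩
      exact ⟨inv_ne_zero hYc, ⟨(x, y), by simp [hx, hy, h]⟩⟩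
  have hmac : ∀ i, macT Q (innerDist S Y) i =
      (Y.card : ℂ)⁻¹ * (Fintype.card X : ℂ) * ∑ x ∈ Y, ∑ y ∈ Y, S.E i x y := by
    intro i
    have h1 : ∀ x y, S.E i x y = (Fintype.card X : ℂ)⁻¹ * ∑ j, S.A j x y * Q j i := by
      intro x y; rw [hE]; simp [hr]
    simp only [macT, innerDist, h1, ← Finset.mul_sum, mul_assoc]
    rw [← mul_assoc (Fintype.card X : ℂ), mul_inv_cancel₀ hXc, one_mul]
    congr 1
    simp only [Finset.sum_mul]
    rw [Finset.sum_comm]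
    refine Finset.sum_congr rfl fun x _ => ?_
    rw [Finset.sum_comm]
  have hw : ∀ k : Fin (n+1), (ws:ℕ) < k → ∑ x ∈ Y, ∑ y ∈ Y, S.E k x y = 0 := by
    intro k hk
    by_contra h
    have h2 : macT Q (innerDist S Y) k ≠ 0 := by
      rw [hmac]; exact mul_ne_zero (mul_ne_zero (inv_ne_zero hYc) hXc) h
    have := hws.2 h2
    exact absurd hk (not_lt.2 this)
  set s := Nat.card {i : Fin (n + 1) | i ≠ 0 ∧ innerDist S Y i ≠ 0} with hs
  have ha0 : innerDist S Y 0 ≠ 0 := (ha 0).2 ⟨y₀, hy₀, y₀, hy₀, (hr0 _ _).2 rfl⟩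
  let T : Finset (Fin (n+1)) := Finset.univ.filter fun i => innerDist S Y i ≠ 0
  have hTm : ∀ i, i ∈ T ↔ innerDist S Y i ≠ 0 := by intro i; simp [T]
  have hT : T.card = s + 1 := by
    have h1 : T.erase 0 = Finset.univ.filter fun i => i ≠ 0 ∧ innerDist S Y i ≠ 0 := by
      ext i; simp [T]
    have h2 : (T.erase 0).card = s := by
      rw [h1, hs, Nat.card_eq_fintype_card, ← Fintype.card_subtype]
      rfl
    rw [← h2, Finset.card_erase_add_one ((hTm 0).2 ha0)]
  have hsn : s ≤ n := by
    have := Finset.card_le_univ T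
    rw [hT] at this
    simpa using this
  let f := T.orderEmbOfFin hT
  have hf0 : f 0 = 0 := by
    have := Finset.orderEmbOfFin_zero hT (by omega)
    have h2 : f 0 = T.min' _ := this
    rw [h2]
    exact le_antisymm (Finset.min'_le _ _ ((hTm 0).2 ha0)) (Fin.zero_le _)
  have hfT : ∀ j, innerDist S Y (f j) ≠ 0 := fun j => (hTm _).1 (Finset.orderEmbOfFin_mem T hT j)
  have hfs : ∀ i, innerDist S Y i ≠ 0 → ∃ j, f j = i := by
    intro i hi
    have : i ∈ Set.range f := by
      rw [Finset.range_orderEmbOfFin]; exact (hTm i).2 hi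
    exact this
  have hrY : ∀ x y : {x // x ∈ Y}, ∃ j, f j = r x.1 y.1 := fun x y =>
    hfs _ ((ha _).2 ⟨x.1, x.2, y.1, y.2, rfl⟩)
  choose rY hrY using hrY
  have hrY0 : ∀ x y, rY x y = 0 ↔ x = y := by
    intro x y
    rw [← f.injective.eq_iff, hrY, hf0, hr0, Subtype.ext_iff]
  have hrYs : ∀ x y, rY x y = rY y x := by
    intro x y
    rw [← f.injective.eq_iff, hrY, hrY, hrsym]
  have hsurj : ∀ a, ∃ x y, rY x y = a := by
    intro a
    obtain ⟨x, hx, y, hy, h⟩ := (ha _).1 (hfT a)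
    exact ⟨⟨x, hx⟩, ⟨y, hy⟩, f.injective (by rw [hrY]; exact h)⟩
  let θ : Fin (s+1) → ℝ := fun a => ((Fintype.card X : ℂ)⁻¹ * Q (f a) ⟨1, by omega⟩).re
  let ζ : Fin (s+1) → ℝ := fun a => ((Fintype.card X : ℂ)⁻¹ * Q (f a) (Fin.last n)).re
  have hθv : ∀ x y, (S.E ⟨1, by omega⟩ x.1 y.1).re = θ (rY x y) := by
    intro x y; simp only [θ, hrY, hE]
  have hζv : ∀ x y, (S.E (Fin.last n) x.1 y.1).re = ζ (rY x y) := by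
    intro x y; simp only [ζ, hrY, hE]
  have hθ : Function.Injective θ := by
    intro a b hab
    obtain ⟨x, y, rfl⟩ := hsurj a
    obtain ⟨x', y', rfl⟩ := hsurj b
    rw [← hθv, ← hθv] at hab
    have h1 : S.E ⟨1, by omega⟩ x.1 y.1 = S.E ⟨1, by omega⟩ x'.1 y'.1 := by
      rw [← E_real S hsym, hab, E_real S hsym]
    have h2 := E_one_sep S hn hcom inferInstance _ _ _ _ h1 (r x.1 y.1)
    rw [hr, hr, if_pos rfl] at h2
    have h3 : r x'.1 y'.1 = r x.1 y.1 := by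
      by_contra h; rw [if_neg h] at h2; exact one_ne_zero h2
    apply f.injective
    rw [hrY, hrY, h3]
  have hζ : ζ 0 ≠ 0 := by
    intro h
    have h1 : ∀ x, S.E (Fin.last n) x x = 0 := by
      intro x
      rw [← E_real S hsym, hE, (hr0 x x).2 rfl, ← hf0]
      simp only [ζ] at h
      rw [h]; simp
    apply tr_ne S (Fin.last n)
    simp [Matrix.trace, h1]
  have hKey : ∀ p g : ℝ[X], p.natDegree + g.natDegree + ws < n → ∀ x z : {x // x ∈ Y},
      ∑ y, p.eval (θ (rY x y)) * (g.eval (θ (rY y z)) * ζ (rY y z)) = 0 := by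
    intro p g hpg x z
    have h1 := key_real S Y hn hsym hcom ws hw p g hpg x.1 z.1
    rw [← Finset.sum_coe_sort] at h1
    simp only [hθv, hζv] at h1
    exact h1
  constructor
  · by_contra hlt
    push Not at hlt
    let p : ℝ[X] := ∏ i ∈ Finset.univ.erase (0 : Fin (s+1)), (Polynomial.X - C (θ i))
    have hdeg : p.natDegree = s := by
      simp only [p]
      rw [natDegree_prod_of_monic _ _ (fun i _ => monic_X_sub_C _)]
      simp
    have h := hKey p 1 (by rw [hdeg, natDegree_one]; omega) ⟨y₀, hy₀⟩ ⟨y₀, hy₀⟩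
    rw [Finset.sum_eq_single ⟨y₀, hy₀⟩] at h
    · rw [(hrY0 _ _).2 rfl] at h
      simp [hζ] at h
      simp only [p, eval_prod, Finset.prod_eq_zero_iff] at h
      obtain ⟨a, ha, h⟩ := h
      simp at h ha
      exact ha (hθ (sub_eq_zero.1 h)).symm
    · intro b _ hb
      have : p.eval (θ (rY ⟨y₀, hy₀⟩ b)) = 0 := by
        simp only [p, eval_prod]
        apply Finset.prod_eq_zero (i := rY ⟨y₀, hy₀⟩ b)
        · simp only [Finset.mem_erase, Finset.mem_univ, and_true]
          rw [Ne, hrY0]; exact fun h => hb h.symm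
        · simp
      rw [this, zero_mul]
    · simp
  · intro hwe
    have : Nonempty {x // x ∈ Y} := ⟨⟨y₀, hy₀⟩⟩
    obtain ⟨S', q', hA, hS, hC⟩ := build rY hrY0 hrYs hsurj θ ζ hθ hζ
      (fun p g hpg => hKey p g (by omega))
    refine ⟨f, f.injective, fun j => Or.inr (hfT j), ?_, S', q', ?_, hS, hC⟩
    · rintro i (rfl | hi)
      · exact ⟨0, hf0⟩
      · exact hfs i hi
    · intro j y y'
      rw [hA, hr, ← hrY]
      simp only [f.injective.eq_iff]

end AssocScheme
end

section
/- Let (X, R) be a commutative translation association scheme with n classes on a finite abelian group X, and let Y be a subgroup of X with 1 < |Y| < |X| and inner distribution a. Then for every 0 ≤ i ≤ n, (aQ)_i = |Y| · #(Y° ∩ X_i*); in particular, the inner distribution of the dual code Y° (in the dual scheme) is |Y|^{-1} aQ. -/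
open Matrix BigOperators
open scoped ComplexOrder

namespace AssocScheme

/-- `ε̂`: the normalized conjugate character vector. -/
noncomputable def charVec {X : Type*} [AddCommGroup X] [Fintype X] (ε : AddChar X ℂ) :
    X → ℂ :=
  fun x => ((Real.sqrt (Fintype.card X) : ℂ))⁻¹ * star (ε x)

/-- Idempotents of a translation scheme are translation invariant. -/
lemma E_translate {X : Type*} [AddCommGroup X] [Fintype X] [DecidableEq X] {n : ℕ}
    (S : Scheme X n)
    (htrans : ∀ (i : Fin (n + 1)) (x y z : X), S.A i (x + z) (y + z) = S.A i x y)
    (Q : Matrix (Fin (n + 1)) (Fin (n + 1)) ℂ) (hQ : S.IsQ Q) (i : Fin (n + 1)) (x y z : X) :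
    S.E i (x + z) (y + z) = S.E i x y := by
  rw [hQ i]
  simp [Matrix.sum_apply, htrans]

/-- The eigenvalue of `M` at a character. -/
noncomputable def eigv {X : Type*} [AddCommGroup X] [Fintype X] (M : Matrix X X ℂ)
    (ε : AddChar X ℂ) : ℂ := ∑ y, M 0 y * ε (-y)

lemma mulVec_charVec {X : Type*} [AddCommGroup X] [Fintype X] (M : Matrix X X ℂ)
    (hM : ∀ x y z, M (x + z) (y + z) = M x y) (ε : AddChar X ℂ) :
    M.mulVec (charVec ε) = eigv M ε • charVec ε := by
  funext x
  simp only [Matrix.mulVec, dotProduct, Pi.smul_apply, smul_eq_mul, charVec, eigv]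
  rw [← Equiv.sum_comp (Equiv.addRight x), Finset.sum_mul]
  refine Finset.sum_congr rfl fun y _ => ?_
  have h1 : M x (y + x) = M 0 y := by simpa using hM 0 y x
  have h2 : ∀ w, star (ε w) = ε (-w) := fun w => (AddChar.map_neg_eq_conj ε w).symm
  simp only [Equiv.coe_addRight, h1]
  rw [h2, h2, neg_add, AddChar.map_add_eq_mul]
  ring

lemma charVec_ne_zero {X : Type*} [AddCommGroup X] [Fintype X] (ε : AddChar X ℂ) :
    charVec ε ≠ 0 := by
  intro h
  have h0 := congrFun h 0
  simp [charVec] at h0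

lemma eigv_eq_ite {X : Type*} [AddCommGroup X] [Fintype X] (M : Matrix X X ℂ)
    (hM : ∀ x y z, M (x + z) (y + z) = M x y) (hMM : M * M = M) (ε : AddChar X ℂ)
    [Decidable (M.mulVec (charVec ε) = charVec ε)] :
    eigv M ε = if M.mulVec (charVec ε) = charVec ε then 1 else 0 := by
  have h := mulVec_charVec M hM ε
  have h2 : M.mulVec (M.mulVec (charVec ε)) = M.mulVec (charVec ε) := by
    rw [Matrix.mulVec_mulVec, hMM]
  rw [h, Matrix.mulVec_smul, h, smul_smul] at h2
  have h3 := smul_left_injective ℂ (charVec_ne_zero ε) h2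
  split_ifs with hc
  · rw [h] at hc
    exact smul_left_injective ℂ (charVec_ne_zero ε)
      (show eigv M ε • charVec ε = (1 : ℂ) • charVec ε by rw [hc, one_smul])
  · by_contra h0
    apply hc
    have : eigv M ε = 1 := mul_left_cancel₀ h0 (by simpa using h3)
    rw [h, this, one_smul]

lemma sum_subgroup {X : Type*} [AddCommGroup X] (Y : AddSubgroup X) [Fintype {x // x ∈ Y}]
    (ε : AddChar X ℂ) [Decidable (∀ y ∈ Y, ε y = 1)] :
    ∑ y : {x // x ∈ Y}, ε y = if ∀ y ∈ Y, ε y = 1 then (Fintype.card {x // x ∈ Y} : ℂ) else 0 := by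
  classical
  have h := AddChar.sum_eq_ite (ε.compAddMonoidHom Y.subtype)
  have h' : ε.compAddMonoidHom Y.subtype = 0 ↔ ∀ y ∈ Y, ε y = 1 := by
    rw [AddChar.ext_iff]
    simp
  simpa [h'] using h

lemma sum_eigv {X : Type*} [AddCommGroup X] [Fintype X] (M : Matrix X X ℂ) (y : X) :
    ∑ ε : AddChar X ℂ, eigv M ε * ε y = (Fintype.card X : ℂ) * M 0 y := by
  classical
  have h : ∀ ε : AddChar X ℂ, eigv M ε * ε y = ∑ z, M 0 z * ε (y - z) := by
    intro ε
    rw [eigv, Finset.sum_mul]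
    refine Finset.sum_congr rfl fun z _ => ?_
    rw [sub_eq_add_neg, AddChar.map_add_eq_mul]
    ring
  simp_rw [h]
  rw [Finset.sum_comm]
  simp_rw [← Finset.mul_sum, AddChar.sum_apply_eq_ite, sub_eq_zero]
  simp [mul_comm]

/-- for a subgroup `Y` of a translation association scheme,
`(aQ)_i = |Y| · #(Y° ∩ X_i*)` for all `i`; equivalently, the inner distribution of the
dual code `Y°` is `|Y|⁻¹ aQ`. -/
theorem translation_scheme_macwilliams {X : Type*} [AddCommGroup X] [Fintype X]
    [DecidableEq X] {n : ℕ} (hn : 1 ≤ n) (hX : 2 ≤ Fintype.card X) (S : Scheme X n)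
    (htrans : ∀ (i : Fin (n + 1)) (x y z : X), S.A i (x + z) (y + z) = S.A i x y)
    (Q : Matrix (Fin (n + 1)) (Fin (n + 1)) ℂ) (hQ : S.IsQ Q)
    (Y : AddSubgroup X) [Fintype {x // x ∈ Y}] [DecidablePred (· ∈ Y)]
    (hY1 : 1 < Fintype.card {x // x ∈ Y}) (hY2 : Fintype.card {x // x ∈ Y} < Fintype.card X) :
    ∀ i : Fin (n + 1),
      macT Q (innerDist S (Finset.univ.filter (· ∈ Y))) i =
        (Fintype.card {x // x ∈ Y} : ℂ) *
          (Nat.card {ε : AddChar X ℂ //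
            (∀ y ∈ Y, ε y = 1) ∧ (S.E i).mulVec (charVec ε) = charVec ε} : ℂ) := by
  intro i
  classical
  have hE := E_translate S htrans Q hQ i
  have hEE : S.E i * S.E i = S.E i := by simpa using S.E_mul i i
  have hX0 : (Fintype.card X : ℂ) ≠ 0 := by
    exact_mod_cast (by omega : Fintype.card X ≠ 0)
  have hY0 : (Fintype.card {x // x ∈ Y} : ℂ) ≠ 0 := by
    exact_mod_cast (by omega : Fintype.card {x // x ∈ Y} ≠ 0)
  have hcard : (Finset.univ.filter (· ∈ Y)).card = Fintype.card {x // x ∈ Y} :=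
    (Fintype.card_subtype _).symm
  have hsum : ∀ f : X → ℂ, ∑ x ∈ Finset.univ.filter (· ∈ Y), f x = ∑ x : {x // x ∈ Y}, f x :=
    fun f => Finset.sum_subtype _ (by simp) f
  have hQE : ∀ x y, ∑ j, Q j i * S.A j x y = (Fintype.card X : ℂ) * S.E i x y := by
    intro x y
    conv_rhs => rw [hQ i]
    simp [Matrix.sum_apply, hX0]
  have hrow : ∀ x : {x // x ∈ Y}, ∑ y : {x // x ∈ Y}, S.E i x y
      = ∑ y : {x // x ∈ Y}, S.E i 0 y := by
    intro x
    rw [← Equiv.sum_comp (Equiv.addRight x)]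
    refine Finset.sum_congr rfl fun y _ => ?_
    simpa using hE 0 y x
  have hL : macT Q (innerDist S (Finset.univ.filter (· ∈ Y))) i
      = (Fintype.card X : ℂ) * ∑ y : {x // x ∈ Y}, S.E i 0 y := by
    calc macT Q (innerDist S (Finset.univ.filter (· ∈ Y))) i
        = (Fintype.card {x // x ∈ Y} : ℂ)⁻¹ *
          ∑ x : {x // x ∈ Y}, ∑ y : {x // x ∈ Y}, ∑ j, Q j i * S.A j x y := by
          simp only [macT, innerDist, hcard, hsum]
          simp_rw [mul_assoc, ← Finset.mul_sum]
          congr 1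
          simp_rw [Finset.sum_mul]
          rw [Finset.sum_comm]
          refine Finset.sum_congr rfl fun x _ => ?_
          rw [Finset.sum_comm]
          refine Finset.sum_congr rfl fun y _ => Finset.sum_congr rfl fun j _ => mul_comm _ _
      _ = _ := by
          simp_rw [hQE, ← Finset.mul_sum, hrow]
          rw [Finset.sum_const, Finset.card_univ, nsmul_eq_mul]
          field_simp
  rw [hL, Nat.card_eq_fintype_card, Fintype.card_subtype
    (fun ε : AddChar X ℂ => (∀ y ∈ Y, ε y = 1) ∧ (S.E i).mulVec (charVec ε) = charVec ε),
    Finset.card_filter]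
  push_cast
  calc (Fintype.card X : ℂ) * ∑ y : {x // x ∈ Y}, S.E i 0 y
      = ∑ y : {x // x ∈ Y}, ∑ ε : AddChar X ℂ, eigv (S.E i) ε * ε y := by
        simp_rw [sum_eigv, Finset.mul_sum]
    _ = ∑ ε : AddChar X ℂ, eigv (S.E i) ε * ∑ y : {x // x ∈ Y}, ε y := by
        rw [Finset.sum_comm]
        simp_rw [Finset.mul_sum]
    _ = _ := by
        rw [Finset.mul_sum]
        refine Finset.sum_congr rfl fun ε _ => ?_
        rw [sum_subgroup, eigv_eq_ite _ hE hEE]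
        by_cases h1 : ∀ y ∈ Y, ε y = 1 <;>
          by_cases h2 : (S.E i).mulVec (charVec ε) = charVec ε <;> simp [h1, h2]

end AssocScheme
end

section
/- Let (X, R) be a symmetric association scheme with n classes, let T ⊆ {1, …, n}, and let Y ⊆ X be a T-code. If b = (b_0, b_1, …, b_n) ∈ ℝ^{n+1} satisfies b_0 = 1, b_j ≥ 0 for all 0 ≤ j ≤ n, and Σ_{j=0}^n b_j Q_{ij} ≤ 0 for every i ∈ {1, …, n} \ T, then |Y| ≤ Σ_{j=0}^n b_j Q_{0j} = Σ_{j=0}^n b_j m_j (the linear programming bound). -/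
open Matrix BigOperators
open scoped ComplexOrder

namespace AssocScheme

/-- The quadratic form of a Hermitian idempotent at a characteristic vector is nonnegative. -/
lemma sum_E_nonneg {X : Type*} [Fintype X] [DecidableEq X] {n : ℕ} (S : Scheme X n)
    (Y : Finset X) (j : Fin (n + 1)) : 0 ≤ ∑ x ∈ Y, ∑ y ∈ Y, S.E j x y := by
  have h1 : ∀ x y, S.E j x y = ∑ z, star (S.E j z x) * S.E j z y := by
    intro x y
    have h := S.E_mul j j
    rw [if_pos rfl] at h
    have h2 := congrFun (congrFun h x) y
    rw [Matrix.mul_apply] at h2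
    rw [← h2]
    refine Finset.sum_congr rfl fun z _ => ?_
    rw [(S.E_herm j).apply x z]
  have h3 : ∑ x ∈ Y, ∑ y ∈ Y, S.E j x y
      = ∑ z, star (∑ x ∈ Y, S.E j z x) * (∑ y ∈ Y, S.E j z y) := by
    rw [Finset.sum_congr rfl fun x _ => Finset.sum_congr rfl fun y _ => h1 x y]
    simp_rw [star_sum, Finset.sum_mul_sum]
    rw [Finset.sum_comm (s := Finset.univ)]
    refine Finset.sum_congr rfl fun x _ => ?_
    rw [Finset.sum_comm]
  rw [h3]
  exact Finset.sum_nonneg fun z _ => star_mul_self_nonneg _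

/-- Delsarte's linear programming bound: if `Y` is a `T`-code and
`b` is a feasible solution of the dual linear program, then
`|Y| ≤ ∑_j b_j Q_{0j} = ∑_j b_j m_j`. -/
theorem linear_programming_bound {X : Type*} [Fintype X] [DecidableEq X] [Nonempty X]
    {n : ℕ} (hn : 1 ≤ n) (S : Scheme X n) (hsym : S.IsSym)
    (Q : Matrix (Fin (n + 1)) (Fin (n + 1)) ℂ) (hQ : S.IsQ Q)
    (T : Finset (Fin (n + 1))) (hT : (0 : Fin (n + 1)) ∉ T)
    (Y : Finset X) (hY1 : 1 < Y.card) (hY2 : Y.card < Fintype.card X)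
    (hYcode : ∀ i ∈ T, innerDist S Y i = 0)
    (b : Fin (n + 1) → ℝ) (hb0 : b 0 = 1) (hbnn : ∀ j, 0 ≤ b j)
    (hbfeas : ∀ i : Fin (n + 1), i ≠ 0 → i ∉ T → (∑ j, (b j : ℂ) * Q i j) ≤ 0) :
    (Y.card : ℂ) ≤ ∑ j, (b j : ℂ) * Q 0 j := by
  classical
  have hYpos : (0 : ℂ) < (Y.card : ℂ) := by exact_mod_cast (by omega : 0 < Y.card)
  have hXpos : (0 : ℂ) < (Fintype.card X : ℂ) := by
    exact_mod_cast (by omega : 0 < Fintype.card X)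
  have hAnn : ∀ i, 0 ≤ ∑ x ∈ Y, ∑ y ∈ Y, S.A i x y := fun i =>
    Finset.sum_nonneg fun x _ => Finset.sum_nonneg fun y _ => by
      rcases S.A_zeroOne i x y with h | h <;> simp [h]
  have hA0 : ∑ x ∈ Y, ∑ y ∈ Y, S.A 0 x y = (Y.card : ℂ) := by
    rw [S.A_zero]
    simp [Matrix.one_apply]
  have hAT : ∀ i ∈ T, ∑ x ∈ Y, ∑ y ∈ Y, S.A i x y = 0 := by
    intro i hi
    have h := hYcode i hi
    unfold innerDist at h
    exact (mul_eq_zero.mp h).resolve_left (inv_ne_zero hYpos.ne')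
  have hE0 : ∑ x ∈ Y, ∑ y ∈ Y, S.E 0 x y
      = (Fintype.card X : ℂ)⁻¹ * ((Y.card : ℂ) * (Y.card : ℂ)) := by
    rw [S.E_zero]
    simp
    ring
  have hE : ∀ j, ∑ x ∈ Y, ∑ y ∈ Y, S.E j x y
      = (Fintype.card X : ℂ)⁻¹ * ∑ i, Q i j * ∑ x ∈ Y, ∑ y ∈ Y, S.A i x y := by
    intro j
    rw [hQ j]
    simp only [Matrix.smul_apply, Matrix.sum_apply, smul_eq_mul, ← Finset.mul_sum]
    congr 1
    simp only [Finset.mul_sum]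
    rw [Finset.sum_comm (s := Finset.univ)]
    refine Finset.sum_congr rfl fun x _ => ?_
    rw [Finset.sum_comm]
  have hlow : ∑ x ∈ Y, ∑ y ∈ Y, S.E 0 x y
      ≤ ∑ j, (b j : ℂ) * ∑ x ∈ Y, ∑ y ∈ Y, S.E j x y := by
    have h := Finset.single_le_sum
      (f := fun j => (b j : ℂ) * ∑ x ∈ Y, ∑ y ∈ Y, S.E j x y)
      (fun j _ => mul_nonneg (Complex.zero_le_real.mpr (hbnn j)) (sum_E_nonneg S Y j))
      (Finset.mem_univ (0 : Fin (n + 1)))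
    simpa [hb0] using h
  have hswap : ∑ j, (b j : ℂ) * ∑ x ∈ Y, ∑ y ∈ Y, S.E j x y
      = (Fintype.card X : ℂ)⁻¹ *
        ∑ i, (∑ j, (b j : ℂ) * Q i j) * ∑ x ∈ Y, ∑ y ∈ Y, S.A i x y := by
    simp_rw [hE]
    generalize ha : (fun i => ∑ x ∈ Y, ∑ y ∈ Y, S.A i x y) = a
    have ha' : ∀ i, ∑ x ∈ Y, ∑ y ∈ Y, S.A i x y = a i := fun i => congrFun ha i
    simp_rw [ha']
    simp_rw [Finset.sum_mul, Finset.mul_sum]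
    rw [Finset.sum_comm]
    refine Finset.sum_congr rfl fun i _ => Finset.sum_congr rfl fun j _ => ?_
    ring
  have hup : ∑ i, (∑ j, (b j : ℂ) * Q i j) * ∑ x ∈ Y, ∑ y ∈ Y, S.A i x y
      ≤ (∑ j, (b j : ℂ) * Q 0 j) * (Y.card : ℂ) := by
    rw [Fin.sum_univ_succ, hA0]
    refine add_le_of_nonpos_right (Finset.sum_nonpos fun i _ => ?_)
    by_cases hi : i.succ ∈ T
    · rw [hAT _ hi, mul_zero]
    · exact mul_nonpos_of_nonpos_of_nonneg (hbfeas _ (Fin.succ_ne_zero i) hi) (hAnn _)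
  rw [hswap, hE0] at hlow
  have h1 := mul_le_mul_of_nonneg_left hlow hXpos.le
  rw [mul_inv_cancel_left₀ hXpos.ne', mul_inv_cancel_left₀ hXpos.ne'] at h1
  have h2 := mul_le_mul_of_nonneg_right (h1.trans hup) (inv_nonneg.mpr hYpos.le)
  rwa [mul_inv_cancel_right₀ hYpos.ne', mul_inv_cancel_right₀ hYpos.ne'] at h2

end AssocScheme
end
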